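/- Fix a real Hilbert space V, an integer s ≥ 1 and real coefficients α_0, …, α_s with α_0 = α_1 = 1. Assume the energy identity: there are an integer k* with 1 ≤ k* ≤ s, reals β_{k*}, …, β_s, and symmetric reals (γ_{i,j})_{0≤i,j≤s−1} such that for every semi-negative continuous linear operator Z on V and every u0 ∈ V, ‖R(Z)u0‖² − ‖u0‖² = Σ_{k=k*}^s β_k ‖Z^k u0‖² + Σ_{i,j=0}^{s−1} γ_{i,j} [Z^i u0, Z^j u0]. Suppose the leading submatrix Γ* := (γ_{i,j})_{0≤i,j≤k*−1} is negative definite and ν < −β_{k*}/2. Then the filtering method with purely diffusive superviscosity is strongly stable: there exists λ₀ > 0 such that for every semi-negative continuous linear operator Z on V with ‖Z‖ ≤ λ₀ and every u0 ∈ V, ‖u_F‖ ≤ ‖u0‖, where u_F := (I + ν(Z†)^{k*}Z^{k*}) R(Z) u0. -/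

import Mathlib

open RealInnerProductSpace ContinuousLinearMap

/-- The semi-inner-product `[v, w] := −⟨Zv, w⟩ − ⟨v, Zw⟩` associated with `Z`. -/
noncomputable def semiIP {V : Type*} [NormedAddCommGroup V] [InnerProductSpace ℝ V]
    (Z : V →L[ℝ] V) (v w : V) : ℝ :=
  -⟪Z v, w⟫ - ⟪v, Z w⟫

section SemiInnerProduct

variable {V : Type*} [NormedAddCommGroup V] [InnerProductSpace ℝ V] {Z : V →L[ℝ] V}

lemma semiIP_self (Z : V →L[ℝ] V) (v : V) : semiIP Z v v = -2 * ⟪Z v, v⟫ := by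
  rw [semiIP, real_inner_comm (Z v) v]; ring

lemma semiIP_self_nonneg (hZ : ∀ v : V, ⟪Z v, v⟫ ≤ 0) (v : V) : 0 ≤ semiIP Z v v := by
  rw [semiIP_self]; linarith [hZ v]

lemma semiIP_self_le (Z : V →L[ℝ] V) (v : V) : semiIP Z v v ≤ 2 * ‖Z‖ * ‖v‖ ^ 2 := by
  rw [semiIP_self]
  have h₁ := neg_le_of_abs_le (abs_real_inner_le_norm (Z v) v)
  have h₂ := mul_le_mul_of_nonneg_right (Z.le_opNorm v) (norm_nonneg v)
  nlinarith

lemma semiIP_comm (Z : V →L[ℝ] V) (v w : V) : semiIP Z v w = semiIP Z w v := by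
  rw [semiIP, semiIP, real_inner_comm (Z v) w, real_inner_comm (Z w) v]; ring

lemma mul_semiIP_le (hZ : ∀ v : V, ⟪Z v, v⟫ ≤ 0) {δ : ℝ} (hδ : 0 < δ) (g : ℝ) (v w : V) :
    g * semiIP Z v w ≤ δ * semiIP Z v v + g ^ 2 / (4 * δ) * semiIP Z w w := by
  have h := semiIP_self_nonneg hZ (δ • v - (g / 2) • w)
  have hexp : semiIP Z (δ • v - (g / 2) • w) (δ • v - (g / 2) • w)
      = δ * (δ * semiIP Z v v + g ^ 2 / (4 * δ) * semiIP Z w w - g * semiIP Z v w) := by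
    simp only [semiIP, map_sub, map_smul, inner_sub_left, inner_sub_right, real_inner_smul_left,
      real_inner_smul_right, real_inner_comm (Z v) w, real_inner_comm (Z w) v,
      real_inner_comm (Z v) v, real_inner_comm (Z w) w]
    field_simp
    ring
  rw [hexp] at h
  linarith [nonneg_of_mul_nonneg_right h hδ]

lemma semiIP_sum_smul {ι : Type*} [Fintype ι] (Z : V →L[ℝ] V) (a : ι → ℝ) (v : ι → V) :
    semiIP Z (∑ i, a i • v i) (∑ i, a i • v i)
      = ∑ i, ∑ j, a i * a j * semiIP Z (v i) (v j) := by
  simp only [semiIP, map_sum, map_smul, sum_inner, inner_sum, real_inner_smul_left,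
    real_inner_smul_right, mul_sub, mul_neg, Finset.sum_sub_distrib, Finset.sum_neg_distrib,
    mul_assoc]
  congr 1
  · rw [Finset.sum_comm]
    simp only [mul_left_comm]
  · rw [Finset.sum_comm]
    simp only [mul_left_comm]

open scoped MatrixOrder Matrix.Norms.L2Operator in
lemma sum_mul_semiIP_nonneg (hZ : ∀ v : V, ⟪Z v, v⟫ ≤ 0) {n : ℕ}
    {A : Matrix (Fin n) (Fin n) ℝ} (hA : A.PosSemidef) (v : Fin n → V) :
    0 ≤ ∑ i, ∑ j, A i j * semiIP Z (v i) (v j) := by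
  obtain ⟨B, rfl⟩ := CStarAlgebra.nonneg_iff_eq_star_mul_self.mp hA.nonneg
  have h : ∑ i, ∑ j, (star B * B) i j * semiIP Z (v i) (v j)
      = ∑ l, semiIP Z (∑ i, B l i • v i) (∑ i, B l i • v i) := by
    simp only [semiIP_sum_smul, Matrix.mul_apply, Matrix.star_apply, star_trivial,
      Finset.sum_mul]
    rw [Finset.sum_comm' (t' := Finset.univ) (s' := fun _ => Finset.univ) (by simp)]
    rw [Finset.sum_comm]
    rw [Finset.sum_congr rfl fun i _ => Finset.sum_comm]
    exact Finset.sum_comm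
  rw [h]
  exact Finset.sum_nonneg fun l _ => semiIP_self_nonneg hZ _

lemma Matrix.PosDef.exists_sub_smul_one_posSemidef {n : ℕ} {A : Matrix (Fin n) (Fin n) ℝ}
    (hA : A.PosDef) : ∃ ε : ℝ, 0 < ε ∧ (A - ε • (1 : Matrix (Fin n) (Fin n) ℝ)).PosSemidef := by
  obtain ⟨ε, hε, hle⟩ : ∃ ε : ℝ, 0 < ε ∧ ∀ i, ε ≤ hA.isHermitian.eigenvalues i := by
    rcases isEmpty_or_nonempty (Fin n) with h | h
    · exact ⟨1, one_pos, fun i => h.elim i⟩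
    · obtain ⟨i, hi⟩ := Finite.exists_min hA.isHermitian.eigenvalues
      exact ⟨_, hA.eigenvalues_pos i, hi⟩
  refine ⟨ε, hε, ?_⟩
  set U : Matrix (Fin n) (Fin n) ℝ := ↑hA.isHermitian.eigenvectorUnitary
  have hUU : U * U.conjTranspose = 1 :=
    Unitary.mul_star_self_of_mem hA.isHermitian.eigenvectorUnitary.2
  have hs : A = U * Matrix.diagonal hA.isHermitian.eigenvalues * U.conjTranspose := by
    conv_lhs => rw [hA.isHermitian.spectral_theorem]
    rfl
  have hsub : A - ε • (1 : Matrix (Fin n) (Fin n) ℝ)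
      = U * Matrix.diagonal (fun i => hA.isHermitian.eigenvalues i - ε) * U.conjTranspose := by
    rw [← Matrix.diagonal_sub, ← Matrix.smul_one_eq_diagonal, Matrix.mul_sub, Matrix.sub_mul,
      ← hs, Matrix.mul_smul, Matrix.mul_one, Matrix.smul_mul, hUU]
  rw [hsub]
  refine Matrix.PosSemidef.mul_mul_conjTranspose_same ?_ U
  exact Matrix.PosSemidef.diagonal fun i => sub_nonneg.mpr (hle i)

/-- If the leading block of `γ` is negative definite, the energy form is controlled by the
seminorms of the trailing vectors. -/
lemma exists_sum_mul_semiIP_le {k s : ℕ} (hks : k ≤ s) (hs : 1 ≤ s) (γ : ℕ → ℕ → ℝ)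
    (hmat : (-(Matrix.of (fun i j : Fin k => γ i j))).PosDef) :
    ∃ C : ℝ, 0 ≤ C ∧ ∀ Z : V →L[ℝ] V, (∀ v : V, ⟪Z v, v⟫ ≤ 0) → ∀ (v : ℕ → V) (b : ℝ), 0 ≤ b →
      (∀ i, k ≤ i → semiIP Z (v i) (v i) ≤ b) →
      ∑ i ∈ Finset.range s, ∑ j ∈ Finset.range s, γ i j * semiIP Z (v i) (v j) ≤ C * b := by
  obtain ⟨ε, hε, hpsd⟩ := hmat.exists_sub_smul_one_posSemidef
  have hs₀ : (0 : ℝ) < s := by exact_mod_cast hs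
  set δ : ℝ := ε / s ^ 2 with hδ_def
  have hδ : 0 < δ := by positivity
  refine ⟨∑ i ∈ Finset.range s, ∑ j ∈ Finset.range s, (δ + γ i j ^ 2 / (4 * δ)),
    by positivity, fun Z hZ v b hb hv => ?_⟩
  set e : ℝ := ∑ i ∈ Finset.range k, semiIP Z (v i) (v i) with he
  have hnn : ∀ i, 0 ≤ semiIP Z (v i) (v i) := fun i => semiIP_self_nonneg hZ _
  have he₀ : 0 ≤ e := Finset.sum_nonneg fun i _ => hnn i
  have hle : ∀ i, semiIP Z (v i) (v i) ≤ e + b := by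
    intro i
    rcases lt_or_ge i k with h | h
    · have := Finset.single_le_sum (f := fun i => semiIP Z (v i) (v i)) (fun i _ => hnn i)
        (Finset.mem_range.mpr h)
      linarith
    · linarith [hv i h]
  have hterm : ∀ i j, k ≤ j → γ i j * semiIP Z (v i) (v j)
      ≤ δ * e + (δ + γ i j ^ 2 / (4 * δ)) * b := by
    intro i j hj
    have h₁ := mul_semiIP_le hZ hδ (γ i j) (v i) (v j)
    have h₂ := mul_le_mul_of_nonneg_left (hle i) hδ.le
    have h₃ := mul_le_mul_of_nonneg_left (hv j hj) (by positivity : 0 ≤ γ i j ^ 2 / (4 * δ))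
    linarith
  have hterm' : ∀ i j, k ≤ i → γ i j * semiIP Z (v i) (v j)
      ≤ δ * e + (δ + γ i j ^ 2 / (4 * δ)) * b := by
    intro i j hi
    have h₁ := mul_semiIP_le hZ hδ (γ i j) (v j) (v i)
    have h₂ := mul_le_mul_of_nonneg_left (hle j) hδ.le
    have h₃ := mul_le_mul_of_nonneg_left (hv i hi) (by positivity : 0 ≤ γ i j ^ 2 / (4 * δ))
    rw [semiIP_comm Z (v i) (v j)]
    linarith
  have hlead : ∑ i ∈ Finset.range k, ∑ j ∈ Finset.range k, γ i j * semiIP Z (v i) (v j)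
      ≤ -(ε * e) := by
    have h := sum_mul_semiIP_nonneg hZ hpsd (fun i => v i)
    simp only [Matrix.sub_apply, Matrix.neg_apply, Matrix.of_apply, Matrix.smul_apply,
      Matrix.one_apply, smul_eq_mul, mul_ite, mul_one, mul_zero, sub_mul, ite_mul, zero_mul,
      neg_mul, Finset.sum_sub_distrib, Finset.sum_neg_distrib, Finset.sum_ite_eq,
      Finset.mem_univ, if_true] at h
    simp only [he, Finset.sum_range, Finset.mul_sum]
    linarith
  have hpoint : ∀ i j, γ i j * semiIP Z (v i) (v j)
      ≤ (if i < k then if j < k then γ i j * semiIP Z (v i) (v j) else 0 else 0)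
        + (δ * e + (δ + γ i j ^ 2 / (4 * δ)) * b) := by
    intro i j
    split_ifs with hi hj
    · have : 0 ≤ δ * e + (δ + γ i j ^ 2 / (4 * δ)) * b := by positivity
      linarith
    · linarith [hterm i j (not_lt.mp hj)]
    · linarith [hterm' i j (not_lt.mp hi)]
  have hfilter : (Finset.range s).filter (· < k) = Finset.range k := by
    ext i; simp only [Finset.mem_filter, Finset.mem_range]; omega
  have hite : ∑ i ∈ Finset.range s, ∑ j ∈ Finset.range s,
      (if i < k then if j < k then γ i j * semiIP Z (v i) (v j) else 0 else 0)
      = ∑ i ∈ Finset.range k, ∑ j ∈ Finset.range k, γ i j * semiIP Z (v i) (v j) := by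
    rw [← hfilter, Finset.sum_filter]
    refine Finset.sum_congr rfl fun i _ => ?_
    split_ifs
    · rw [Finset.sum_filter]
    · simp
  have hsum := Finset.sum_le_sum fun i (_ : i ∈ Finset.range s) =>
    Finset.sum_le_sum fun j (_ : j ∈ Finset.range s) => hpoint i j
  simp only [Finset.sum_add_distrib (g := fun i => δ * e + _), Finset.sum_add_distrib, hite,
    Finset.sum_const, Finset.card_range, nsmul_eq_mul] at hsum
  have hδe : (s : ℝ) * (s * (δ * e)) = ε * e := by
    rw [hδ_def]; field_simp
  simp only [← Finset.sum_mul, Finset.sum_add_distrib, Finset.sum_const, Finset.card_range,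
    nsmul_eq_mul] at hsum ⊢
  linarith

end SemiInnerProduct

section Powers

variable {V : Type*} [NormedAddCommGroup V] [NormedSpace ℝ V]

lemma norm_pow_apply_le {Z : V →L[ℝ] V} {l : ℝ} (hZ : ‖Z‖ ≤ l) (n : ℕ) (v : V) :
    ‖(Z ^ n) v‖ ≤ l ^ n * ‖v‖ := by
  induction n with
  | zero => simp
  | succ n ih =>
    have hl : 0 ≤ l := (norm_nonneg Z).trans hZ
    rw [pow_succ', mul_apply_eq_comp]
    calc ‖Z ((Z ^ n) v)‖ ≤ l * ‖(Z ^ n) v‖ := Z.le_of_opNorm_le hZ _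
      _ ≤ l * (l ^ n * ‖v‖) := by gcongr
      _ = l ^ (n + 1) * ‖v‖ := by ring

lemma norm_polynomial_sub_self_le {Z : V →L[ℝ] V} {l : ℝ} (hZ : ‖Z‖ ≤ l) (hl : l ≤ 1) (s : ℕ)
    {α : ℕ → ℝ} (hα : α 0 = 1) (v : V) :
    ‖(∑ j ∈ Finset.range (s + 1), α j • Z ^ j) v - v‖
      ≤ (∑ j ∈ Finset.range s, |α (j + 1)|) * l * ‖v‖ := by
  have hl₀ : 0 ≤ l := (norm_nonneg Z).trans hZ
  have h : (∑ j ∈ Finset.range (s + 1), α j • Z ^ j) v - v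
      = ∑ j ∈ Finset.range s, α (j + 1) • (Z ^ (j + 1)) v := by
    simp [Finset.sum_range_succ', hα]
  rw [h, Finset.sum_mul, Finset.sum_mul]
  refine norm_sum_le_of_le _ fun j _ => ?_
  rw [norm_smul, Real.norm_eq_abs, mul_assoc]
  have hp : l ^ (j + 1) ≤ l := pow_le_of_le_one hl₀ hl j.succ_ne_zero
  have := norm_pow_apply_le hZ (j + 1) v
  gcongr
  exact this.trans (by gcongr)

lemma sum_mul_norm_pow_apply_le {Z : V →L[ℝ] V} {l : ℝ} (hZ : ‖Z‖ ≤ l) (hl : l ≤ 1) {k s : ℕ}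
    (hks : k ≤ s) (β : ℕ → ℝ) (v : V) :
    ∑ j ∈ Finset.Icc k s, β j * ‖(Z ^ j) v‖ ^ 2
      ≤ (β k + (∑ j ∈ Finset.Ioc k s, |β j|) * l) * ‖(Z ^ k) v‖ ^ 2 := by
  have hl₀ : 0 ≤ l := (norm_nonneg Z).trans hZ
  rw [← Finset.add_sum_Ioc_eq_sum_Icc hks, add_mul, Finset.sum_mul, Finset.sum_mul]
  refine add_le_add_right (Finset.sum_le_sum fun j hj => ?_) _
  obtain ⟨n, rfl⟩ := Nat.exists_eq_add_of_lt (Finset.mem_Ioc.mp hj).1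
  have h := norm_pow_apply_le hZ (n + 1) ((Z ^ k) v)
  rw [← mul_apply_eq_comp, ← pow_add, add_comm (n + 1) k, ← add_assoc] at h
  have hp : (l ^ (n + 1)) ^ 2 ≤ l := by
    rw [← pow_mul]; exact pow_le_of_le_one hl₀ hl (by omega)
  calc β (k + n + 1) * ‖(Z ^ (k + n + 1)) v‖ ^ 2
      ≤ |β (k + n + 1)| * (l ^ (n + 1) * ‖(Z ^ k) v‖) ^ 2 := by
        gcongr; exact le_abs_self _
    _ = |β (k + n + 1)| * (l ^ (n + 1)) ^ 2 * ‖(Z ^ k) v‖ ^ 2 := by ring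
    _ ≤ |β (k + n + 1)| * l * ‖(Z ^ k) v‖ ^ 2 := by gcongr

end Powers

lemma norm_sq_one_add_smul_adjoint_pow_mul_pow {V : Type*} [NormedAddCommGroup V]
    [InnerProductSpace ℝ V] [CompleteSpace V] (Z : V →L[ℝ] V) (k : ℕ) (ν : ℝ) (u : V) :
    ‖((1 : V →L[ℝ] V) + ν • (adjoint Z ^ k * Z ^ k)) u‖ ^ 2
      = ‖u‖ ^ 2 + 2 * ν * ‖(Z ^ k) u‖ ^ 2 + ν ^ 2 * ‖(adjoint Z ^ k) ((Z ^ k) u)‖ ^ 2 := by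
  have hadj : adjoint Z ^ k = adjoint (Z ^ k) := (star_pow Z k).symm
  have hin : ⟪u, (adjoint Z ^ k) ((Z ^ k) u)⟫ = ‖(Z ^ k) u‖ ^ 2 := by
    rw [hadj, adjoint_inner_right, real_inner_self_eq_norm_sq]
  simp only [add_apply, one_apply_eq_self,
    smul_apply, mul_apply_eq_comp]
  rw [norm_add_sq_real, real_inner_smul_right, hin, norm_smul, mul_pow, Real.norm_eq_abs, sq_abs]
  ring

lemma two_mul_mul_add_le {ν A l x y z : ℝ} (hA : 0 ≤ A) (hl₀ : 0 ≤ l) (hl : l ≤ 1) (hx : 0 ≤ x)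
    (hy : 0 ≤ y) (hz : 0 ≤ z) (hyx : |y - x| ≤ A * l * x) (hzy : z ≤ l * y) :
    2 * ν * y ^ 2 + ν ^ 2 * z ^ 2
      ≤ (2 * ν + (2 * |ν| * (A * (2 + A)) + ν ^ 2 * (1 + A) ^ 2) * l) * x ^ 2 := by
  have hAl : A * l * x ≤ A * x := by
    have := mul_le_mul_of_nonneg_left hl (mul_nonneg hA hx); linarith
  have hyx' : y ≤ (1 + A) * x := by linarith [le_of_abs_le hyx]
  have h₁ : 2 * (ν * (y ^ 2 - x ^ 2)) ≤ 2 * (|ν| * ((A * l * x) * ((2 + A) * x))) := by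
    refine mul_le_mul_of_nonneg_left ((le_abs_self _).trans ?_) zero_le_two
    rw [abs_mul, sq_sub_sq, abs_mul, mul_comm |y + x|, abs_of_nonneg (add_nonneg hy hx)]
    gcongr
    linarith
  have h₂ : z ^ 2 ≤ l * ((1 + A) * x) ^ 2 := by
    calc z ^ 2 ≤ (l * ((1 + A) * x)) ^ 2 := by gcongr; exact hzy.trans (by gcongr)
      _ = l ^ 2 * ((1 + A) * x) ^ 2 := by ring
      _ ≤ l * ((1 + A) * x) ^ 2 := by gcongr; exact pow_le_of_le_one hl₀ hl two_ne_zero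
  have h₃ := mul_le_mul_of_nonneg_left h₂ (sq_nonneg ν)
  linarith

/-- strong stability of the filtering method with purely diffusive
superviscosity `ν < −β_{k*}/2`, assuming the leading submatrix `Γ*` is negative definite. -/
theorem filtering_diffusive_strongly_stable
    {V : Type*} [NormedAddCommGroup V] [InnerProductSpace ℝ V] [CompleteSpace V]
    (s : ℕ) (hs : 1 ≤ s) (α : ℕ → ℝ) (hα0 : α 0 = 1) (hα1 : α 1 = 1)
    (kst : ℕ) (hk1 : 1 ≤ kst) (hks : kst ≤ s)
    (β : ℕ → ℝ) (γ : ℕ → ℕ → ℝ) (hsym : ∀ i j, γ i j = γ j i)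
    (hidentity : ∀ Z : V →L[ℝ] V, (∀ v : V, ⟪Z v, v⟫ ≤ 0) → ∀ u0 : V,
      ‖(∑ j ∈ Finset.range (s + 1), α j • Z ^ j) u0‖ ^ 2 - ‖u0‖ ^ 2
        = ∑ k ∈ Finset.Icc kst s, β k * ‖(Z ^ k) u0‖ ^ 2
          + ∑ i ∈ Finset.range s, ∑ j ∈ Finset.range s,
              γ i j * semiIP Z ((Z ^ i) u0) ((Z ^ j) u0))
    (hmat : (-(Matrix.of (fun i j : Fin kst => γ i j))).PosDef)
    (ν : ℝ) (hν : ν < -β kst / 2) :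
    ∃ lam0 : ℝ, 0 < lam0 ∧
      ∀ Z : V →L[ℝ] V, (∀ v : V, ⟪Z v, v⟫ ≤ 0) → ‖Z‖ ≤ lam0 → ∀ u0 : V,
        ‖((1 : V →L[ℝ] V) + ν • (adjoint Z ^ kst * Z ^ kst))
            ((∑ j ∈ Finset.range (s + 1), α j • Z ^ j) u0)‖ ≤ ‖u0‖ := by
  obtain ⟨C, hC, hform⟩ := exists_sum_mul_semiIP_le (V := V) hks hs γ hmat
  set A : ℝ := ∑ j ∈ Finset.range s, |α (j + 1)|
  have hA : 0 ≤ A := Finset.sum_nonneg fun _ _ => abs_nonneg _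
  set b : ℝ := ∑ j ∈ Finset.Ioc kst s, |β j|
  have hb : 0 ≤ b := Finset.sum_nonneg fun _ _ => abs_nonneg _
  set K : ℝ := b + 2 * C + (2 * |ν| * (A * (2 + A)) + ν ^ 2 * (1 + A) ^ 2)
  have hK : 0 ≤ K := by positivity
  have hgap : 0 < -(β kst + 2 * ν) := by linarith
  obtain ⟨l, hl₀, hl, hKl⟩ : ∃ l : ℝ, 0 < l ∧ l ≤ 1 ∧ K * l ≤ -(β kst + 2 * ν) := by
    refine ⟨min 1 (-(β kst + 2 * ν) / (K + 1)), by positivity, min_le_left _ _, ?_⟩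
    calc K * min 1 (-(β kst + 2 * ν) / (K + 1))
        ≤ (K + 1) * (-(β kst + 2 * ν) / (K + 1)) := by
          gcongr
          · linarith
          · exact min_le_right _ _
      _ = -(β kst + 2 * ν) := by field_simp
  refine ⟨l, hl₀, fun Z hZ hZl u0 => ?_⟩
  refine le_of_sq_le_sq ?_ (norm_nonneg u0)
  set R : V →L[ℝ] V := ∑ j ∈ Finset.range (s + 1), α j • Z ^ j
  set w : V := (Z ^ kst) u0 with hw
  have hcomm : (Z ^ kst) (R u0) = R w := by
    have : Commute (Z ^ kst) R := Commute.sum_right _ _ _ fun j _ =>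
      ((Commute.refl Z).pow_pow kst j).smul_right _
    exact DFunLike.congr_fun this.eq u0
  have hpert : |‖R w‖ - ‖w‖| ≤ A * l * ‖w‖ :=
    (abs_norm_sub_norm_le _ _).trans (norm_polynomial_sub_self_le hZl hl s hα0 w)
  have hadj : ‖(adjoint Z ^ kst) (R w)‖ ≤ l * ‖R w‖ := by
    refine (norm_pow_apply_le ((LinearIsometryEquiv.norm_map adjoint Z).trans_le hZl)
      kst _).trans ?_
    gcongr
    exact pow_le_of_le_one hl₀.le hl (by omega)
  have hfilter := two_mul_mul_add_le (ν := ν) hA hl₀.le hl (norm_nonneg w) (norm_nonneg (R w))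
    (norm_nonneg _) hpert hadj
  have hβ := sum_mul_norm_pow_apply_le hZl hl hks β u0
  have hγ := hform Z hZ (fun i => (Z ^ i) u0) (2 * l * ‖w‖ ^ 2) (by positivity) fun i hi => by
    obtain ⟨n, rfl⟩ := Nat.exists_eq_add_of_le hi
    have h := norm_pow_apply_le hZl n w
    rw [hw, ← mul_apply_eq_comp, ← pow_add, add_comm n kst] at h
    refine (semiIP_self_le Z _).trans ?_
    gcongr
    exact h.trans (mul_le_of_le_one_left (norm_nonneg _) (pow_le_one₀ hl₀.le hl))
  have hid := hidentity Z hZ u0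
  rw [norm_sq_one_add_smul_adjoint_pow_mul_pow, hcomm]
  have hfinal : (β kst + 2 * ν + K * l) * ‖w‖ ^ 2 ≤ 0 :=
    mul_nonpos_of_nonpos_of_nonneg (by linarith) (sq_nonneg _)
  simp only [K] at hfinal
  linarith
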